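/- Let I = {i_1 < ⋯ < i_l} be a nonempty finite set of positive integers with m = i_l. Then for every 0 ≤ k ≤ m−1: c_{k+1}(I) = Σ_{i_t ∈ I''∖{m}} c_k(I_t) + Σ_{i_t ∈ I'∖{m}} c_k(Î_t) + d(I⁻, m−1). -/

import Mathlib

/-- The descent set of a permutation of `{1,…,n}` (modeled on `Fin n`), as a set of
1-indexed positions `i ∈ {1, …, n-1}` with `π_i > π_{i+1}`. -/
noncomputable def descSet (n : ℕ) (π : Equiv.Perm (Fin n)) : Finset ℕ :=
  @Finset.filter _
    (fun i => ∃ (h1 : i - 1 < n) (h2 : i < n), π ⟨i, h2⟩ < π ⟨i - 1, h1⟩)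
    (Classical.decPred _) (Finset.Ioo 0 n)

/-- `dCount I n` is the number of permutations of `{1,…,n}` with descent set `I`. -/
noncomputable def dCount (I : Finset ℕ) (n : ℕ) : ℕ :=
  Nat.card {π : Equiv.Perm (Fin n) // descSet n π = I}

/-- `mI I = max (I ∪ {0})`. -/
def mI (I : Finset ℕ) : ℕ := I.sup id

/-- `IsCCoeff I c` says that `c` is the coefficient sequence of the descent polynomial
of `I` in the basis `{C(n+1,k)}_{k=0}^{m}` with signs `(−1)^{m−k}`, i.e.
`d(I,n) = Σ_{k=0}^{m} (−1)^{m−k} c_k·C(n+1,k)` for all integers `n > m`,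
together with `c_k = 0` for `k > m`.  (These conditions determine `c` uniquely.) -/
def IsCCoeff (I : Finset ℕ) (c : ℕ → ℚ) : Prop :=
  (∀ n : ℕ, mI I < n →
      (dCount I n : ℚ) =
        ∑ k ∈ Finset.range (mI I + 1),
          (-1 : ℚ) ^ (mI I - k) * c k * ((n + 1).choose k)) ∧
  (∀ k : ℕ, mI I < k → c k = 0)

/-- For `a = i_t ∈ I`, `Imod I a` is the set
`I_t = {i_1,…,i_{t−1}, i_t−1, i_{t+1}−1, …, i_l−1} \ {0}`. -/
def Imod (I : Finset ℕ) (a : ℕ) : Finset ℕ :=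
  ((I.filter (fun x => x < a)) ∪ ((I.filter (fun x => a ≤ x)).image (fun x => x - 1))).erase 0

/-- For `a = i_t ∈ I`, `Ihat I a` is the set
`Î_t = {i_1,…,i_{t−1}, i_{t+1}−1, …, i_l−1}`. -/
def Ihat (I : Finset ℕ) (a : ℕ) : Finset ℕ :=
  (I.filter (fun x => x < a)) ∪ ((I.filter (fun x => a < x)).image (fun x => x - 1))

/-- `I' = {i ∈ I : i − 1 ∉ I}`. -/
def Iprime (I : Finset ℕ) : Finset ℕ := I.filter (fun a => a - 1 ∉ I)

/-- `I'' = I' \ {1}`. -/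
def Iprime2 (I : Finset ℕ) : Finset ℕ := (Iprime I).erase 1

theorem mem_descSet' {n : ℕ} {π : Equiv.Perm (Fin n)} {i : ℕ} :
    i ∈ descSet n π ↔ 0 < i ∧ ∃ h : i < n, π ⟨i, h⟩ < π ⟨i - 1, by omega⟩ := by
  unfold descSet
  rw [@Finset.mem_filter _ _ (Classical.decPred _), Finset.mem_Ioo]
  constructor
  · rintro ⟨⟨h0, hn⟩, h1, h2, h⟩
    exact ⟨h0, h2, h⟩
  · rintro ⟨h0, h2, h⟩
    exact ⟨⟨h0, h2⟩, by omega, h2, h⟩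

theorem perm_eq_one_of_descSet {n : ℕ} {π : Equiv.Perm (Fin n)} (h : descSet n π = ∅) :
    π = 1 := by
  have hm : StrictMono π := by
    rcases n with _ | n
    · intro a; exact a.elim0
    · rw [Fin.strictMono_iff_lt_succ]
      intro i
      have hi : (i : ℕ) + 1 ∉ descSet (n + 1) π := by rw [h]; simp
      rw [mem_descSet'] at hi
      push Not at hi
      have := hi (by omega) (by omega)
      refine lt_of_le_of_ne this ?_
      intro he
      have := π.injective he
      simp [Fin.ext_iff] at this
  have h2 : (⟨π, by intro a b; exact hm.le_iff_le⟩ : Fin n ≃o Fin n) = OrderIso.refl _ :=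
    Subsingleton.elim _ _
  ext i
  have := congrArg (fun f : Fin n ≃o Fin n => f i) h2
  exact congrArg Fin.val this

theorem descSet_one (n : ℕ) : descSet n 1 = ∅ := by
  ext i
  rw [mem_descSet']
  simp [Fin.lt_def]

theorem dCount_empty (n : ℕ) : dCount ∅ n = 1 := by
  unfold dCount
  rw [Nat.card_eq_one_iff_unique]
  exact ⟨⟨fun a b => Subtype.ext ((perm_eq_one_of_descSet a.2).trans
    (perm_eq_one_of_descSet b.2).symm)⟩, ⟨⟨1, descSet_one n⟩⟩⟩

theorem dCount_eq_zero {J : Finset ℕ} {n i : ℕ} (hi : i ∈ J) (hn : n ≤ i) : dCount J n = 0 := by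
  unfold dCount
  rw [Nat.card_eq_zero]
  left
  constructor
  rintro ⟨π, rfl⟩
  rw [mem_descSet'] at hi
  obtain ⟨_, h, _⟩ := hi
  omega

/-- glue a `p`-subset and permutations of the two blocks -/
noncomputable def glue {p q : ℕ} (S : Finset (Fin (p + q))) (hS : S.card = p)
    (hS' : Sᶜ.card = q) (τ : Equiv.Perm (Fin p)) (ρ : Equiv.Perm (Fin q)) :
    Equiv.Perm (Fin (p + q)) :=
  (finSumFinEquiv.symm.trans (Equiv.Perm.sumCongr τ ρ)).trans (finSumEquivOfFinset hS hS')

theorem glue_left {p q : ℕ} (S : Finset (Fin (p + q))) (hS : S.card = p)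
    (hS' : Sᶜ.card = q) (τ : Equiv.Perm (Fin p)) (ρ : Equiv.Perm (Fin q)) (i : Fin p) :
    glue S hS hS' τ ρ (Fin.castAdd q i) = S.orderEmbOfFin hS (τ i) := by
  simp [glue]

theorem glue_right {p q : ℕ} (S : Finset (Fin (p + q))) (hS : S.card = p)
    (hS' : Sᶜ.card = q) (τ : Equiv.Perm (Fin p)) (ρ : Equiv.Perm (Fin q)) (i : Fin q) :
    glue S hS hS' τ ρ (Fin.natAdd p i) = Sᶜ.orderEmbOfFin hS' (ρ i) := by
  simp [glue]

theorem mem_descSet_glue_left {p q : ℕ} (S : Finset (Fin (p + q))) (hS : S.card = p)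
    (hS' : Sᶜ.card = q) (τ : Equiv.Perm (Fin p)) (ρ : Equiv.Perm (Fin q)) (i : ℕ) (hi : i < p) :
    i ∈ descSet (p + q) (glue S hS hS' τ ρ) ↔ i ∈ descSet p τ := by
  rw [mem_descSet', mem_descSet']
  refine and_congr_right fun h0 => ?_
  have e1 := glue_left S hS hS' τ ρ ⟨i, hi⟩
  have e2 := glue_left S hS hS' τ ρ ⟨i - 1, by omega⟩
  simp only [Fin.castAdd_mk] at e1 e2
  constructor
  · rintro ⟨h, h1⟩
    refine ⟨hi, ?_⟩
    rw [e1, e2] at h1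
    simpa using h1
  · rintro ⟨h, h1⟩
    refine ⟨by omega, ?_⟩
    rw [e1, e2]
    simpa using h1

theorem mem_descSet_glue_right {p q : ℕ} (S : Finset (Fin (p + q))) (hS : S.card = p)
    (hS' : Sᶜ.card = q) (τ : Equiv.Perm (Fin p)) (ρ : Equiv.Perm (Fin q)) (i : ℕ) (hi : 0 < i) :
    p + i ∈ descSet (p + q) (glue S hS hS' τ ρ) ↔ i ∈ descSet q ρ := by
  rw [mem_descSet', mem_descSet']
  have key : ∀ h : i < q, (glue S hS hS' τ ρ ⟨p + i, by omega⟩ <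
      glue S hS hS' τ ρ ⟨p + i - 1, by omega⟩ ↔ ρ ⟨i, h⟩ < ρ ⟨i - 1, by omega⟩) := by
    intro h
    have e1 := glue_right S hS hS' τ ρ ⟨i, h⟩
    have e2 := glue_right S hS hS' τ ρ ⟨i - 1, by omega⟩
    simp only [Fin.natAdd_mk] at e1 e2
    have e3 : (⟨p + i - 1, by omega⟩ : Fin (p + q)) = ⟨p + (i - 1), by omega⟩ := by
      ext; simp; omega
    rw [e3, e1, e2]
    simp
  constructor
  · rintro ⟨_, h, h1⟩
    exact ⟨hi, by omega, (key (by omega)).1 h1⟩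
  · rintro ⟨_, h, h1⟩
    exact ⟨by omega, by omega, (key (by omega)).2 h1⟩

theorem exists_glue {p q : ℕ} (σ : Equiv.Perm (Fin (p + q))) :
    ∃ S hS hS' τ ρ, σ = glue (p := p) (q := q) S hS hS' τ ρ := by
  let S : Finset (Fin (p + q)) := Finset.univ.image (fun i : Fin p => σ (Fin.castAdd q i))
  have hS : S.card = p := by
    rw [Finset.card_image_of_injective _ (fun a b h => by simpa using h)]
    simp
  have hS' : Sᶜ.card = q := by
    rw [Finset.card_compl, hS]; simp
  let e := finSumEquivOfFinset hS hS'
  let θ : Equiv.Perm (Fin p ⊕ Fin q) := (finSumFinEquiv.trans σ).trans e.symm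
  have hθ : Set.MapsTo θ (Set.range Sum.inl) (Set.range Sum.inl) := by
    rintro _ ⟨i, rfl⟩
    have hmem : σ (Fin.castAdd q i) ∈ S := Finset.mem_image_of_mem _ (Finset.mem_univ _)
    have hr : σ (Fin.castAdd q i) ∈ Set.range (S.orderEmbOfFin hS) := by
      rw [Finset.range_orderEmbOfFin]; exact hmem
    obtain ⟨j, hj⟩ := hr
    refine ⟨j, ?_⟩
    simp only [θ, Equiv.trans_apply, finSumFinEquiv_apply_left]
    rw [Equiv.eq_symm_apply, ← hj]
    simp [e]
  obtain ⟨⟨τ, ρ⟩, h⟩ := Equiv.Perm.mem_sumCongrHom_range_of_perm_mapsTo_inl hθ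
  refine ⟨S, hS, hS', τ, ρ, ?_⟩
  have h' : Equiv.Perm.sumCongr τ ρ = θ := h
  unfold glue
  rw [h']
  ext x
  simp [θ, e]

theorem glue_inj {p q : ℕ} {S : Finset (Fin (p + q))} {hS : S.card = p}
    {hS' : Sᶜ.card = q} {τ : Equiv.Perm (Fin p)} {ρ : Equiv.Perm (Fin q)}
    {T : Finset (Fin (p + q))} {hT : T.card = p}
    {hT' : Tᶜ.card = q} {τ' : Equiv.Perm (Fin p)} {ρ' : Equiv.Perm (Fin q)}
    (h : glue S hS hS' τ ρ = glue T hT hT' τ' ρ') : S = T ∧ τ = τ' := by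
  have hST : S = T := by
    apply Finset.coe_injective
    rw [← Finset.range_orderEmbOfFin S hS, ← Finset.range_orderEmbOfFin T hT]
    have h1 : ∀ i, S.orderEmbOfFin hS (τ i) = T.orderEmbOfFin hT (τ' i) := by
      intro i
      rw [← glue_left S hS hS' τ ρ, h, glue_left]
    rw [← τ.surjective.range_comp (S.orderEmbOfFin hS),
      ← τ'.surjective.range_comp (T.orderEmbOfFin hT)]
    congr 1
    exact funext h1
  subst hST
  refine ⟨rfl, ?_⟩
  ext i
  have : S.orderEmbOfFin hS (τ i) = S.orderEmbOfFin hS (τ' i) := by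
    rw [← glue_left S hS hS' τ ρ, h, glue_left]
  rw [(S.orderEmbOfFin hS).injective this]

theorem dCount_choose (J : Finset ℕ) (p n : ℕ) (hJ : ∀ j ∈ J, j < p) (hn : p ≤ n) :
    dCount J n + dCount (insert p J) n = n.choose p * dCount J p := by
  classical
  obtain ⟨q, rfl⟩ := Nat.exists_eq_add_of_le hn
  have hp : p ∉ J := fun h => lt_irrefl _ (hJ p h)
  unfold dCount
  have e1 : Nat.card {π : Equiv.Perm (Fin (p + q)) // descSet (p + q) π = J} +
      Nat.card {π : Equiv.Perm (Fin (p + q)) // descSet (p + q) π = insert p J} =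
      Nat.card {π : Equiv.Perm (Fin (p + q)) // (descSet (p + q) π).erase p = J} := by
    rw [Nat.card_eq_fintype_card, Nat.card_eq_fintype_card, Nat.card_eq_fintype_card,
      ← Fintype.card_subtype_or_disjoint]
    · apply Fintype.card_congr
      apply Equiv.subtypeEquivRight
      intro π
      constructor
      · rintro (h | h)
        · rw [h, Finset.erase_eq_of_notMem hp]
        · rw [h, Finset.erase_insert hp]
      · intro h
        by_cases hm : p ∈ descSet (p + q) π
        · right; rw [← h, Finset.insert_erase hm]
        · left; rw [← h, Finset.erase_eq_of_notMem hm]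
    · rw [Pi.disjoint_iff]
      intro π
      simp only [Prop.disjoint_iff]
      rintro ⟨h1, h2⟩
      rw [h1] at h2
      exact hp (h2 ▸ Finset.mem_insert_self p J)
  rw [e1]
  have e2 : (p + q).choose p = Nat.card {S : Finset (Fin (p + q)) // S.card = p} := by
    rw [Nat.card_eq_fintype_card, Fintype.card_finset_len, Fintype.card_fin]
  rw [e2, ← Nat.card_prod]
  symm
  have hc : ∀ S : Finset (Fin (p + q)), S.card = p → Sᶜ.card = q := by
    intro S hS
    rw [Finset.card_compl, hS]; simp
  refine Nat.card_eq_of_bijective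
    (fun x => ⟨glue x.1.1 x.1.2 (hc _ x.1.2) x.2.1 1, ?_⟩) ⟨?_, ?_⟩
  · obtain ⟨⟨S, hS⟩, ⟨τ, hτ⟩⟩ := x
    ext i
    rw [Finset.mem_erase]
    rcases lt_trichotomy i p with h | h | h
    · simp only [mem_descSet_glue_left _ _ _ _ _ _ h, hτ]
      simp [h.ne]
    · subst h; simp [hp]
    · obtain ⟨r, rfl⟩ := Nat.exists_eq_add_of_le h.le
      rw [mem_descSet_glue_right _ _ _ _ _ _ (by omega), descSet_one]
      simp
      intro h'
      have := hJ _ h'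
      omega
  · rintro ⟨⟨S, hS⟩, ⟨τ, hτ⟩⟩ ⟨⟨T, hT⟩, ⟨τ', hτ'⟩⟩ h
    obtain ⟨h1, h2⟩ := glue_inj (Subtype.ext_iff.1 h)
    simp only at h1 h2
    subst h1
    subst h2
    rfl
  · rintro ⟨σ, hσ⟩
    obtain ⟨S, hS, hS', τ, ρ, rfl⟩ := exists_glue σ
    have hρ : ρ = 1 := by
      apply perm_eq_one_of_descSet
      rw [Finset.eq_empty_iff_forall_notMem]
      intro i hi
      have h0 := (mem_descSet'.1 hi).1
      rw [← mem_descSet_glue_right S hS hS' τ ρ i h0] at hi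
      have : p + i ∈ J := by
        rw [← hσ, Finset.mem_erase]
        exact ⟨by omega, hi⟩
      have := hJ _ this
      omega
    subst hρ
    refine ⟨⟨⟨S, hS⟩, ⟨τ, ?_⟩⟩, rfl⟩
    ext i
    constructor
    · intro hi
      have h0 := (mem_descSet'.1 hi).2.1
      rw [← hσ, Finset.mem_erase, mem_descSet_glue_left _ _ _ _ _ _ h0]
      exact ⟨by omega, hi⟩
    · intro hi
      rw [← mem_descSet_glue_left S hS hS' τ 1 _ (hJ _ hi)]
      rw [← hσ] at hi
      exact (Finset.mem_erase.1 hi).2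

section Sets
variable {K : Finset ℕ} {m : ℕ}

theorem Iprime_insert (hm : ∀ x ∈ K, x < m) :
    (Iprime (insert m K)).erase m = Iprime K := by
  ext a
  simp only [Iprime, Finset.mem_erase, Finset.mem_filter, Finset.mem_insert]
  constructor
  · rintro ⟨h1, h2 | h2, h3⟩
    · omega
    · exact ⟨h2, fun h => h3 (Or.inr h)⟩
  · rintro ⟨h2, h3⟩
    have := hm a h2
    refine ⟨by omega, Or.inr h2, ?_⟩
    rintro (h | h)
    · omega
    · exact h3 h

theorem Iprime2_insert (hm : ∀ x ∈ K, x < m) :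
    (Iprime2 (insert m K)).erase m = Iprime2 K := by
  unfold Iprime2
  rw [Finset.erase_right_comm, Iprime_insert hm]

theorem Imod_insert (hm : ∀ x ∈ K, x < m) {a : ℕ} (ha : a ∈ K) (h0 : 0 < a) :
    Imod (insert m K) a = insert (m - 1) (Imod K a) := by
  have h1 := hm a ha
  ext x
  simp only [Imod, Finset.mem_erase, Finset.mem_union, Finset.mem_filter, Finset.mem_insert,
    Finset.mem_image]
  by_cases hx : x = m - 1
  · subst hx
    exact iff_of_true ⟨by omega, Or.inr ⟨m, ⟨Or.inl rfl, by omega⟩, rfl⟩⟩ (Or.inl rfl)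
  grind

theorem Imod_lt (hm : ∀ x ∈ K, x < m) {a : ℕ} (ha : a ∈ K) (h0 : 0 < a) :
    ∀ x ∈ Imod K a, x < m - 1 := by
  have h1 := hm a ha
  intro x
  simp only [Imod, Finset.mem_erase, Finset.mem_union, Finset.mem_filter, Finset.mem_image]
  grind

theorem Ihat_insert (hm : ∀ x ∈ K, x < m) {a : ℕ} (ha : a ∈ K) :
    Ihat (insert m K) a = insert (m - 1) (Ihat K a) := by
  have h1 := hm a ha
  ext x
  simp only [Ihat, Finset.mem_union, Finset.mem_filter, Finset.mem_insert,
    Finset.mem_image]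
  grind

theorem Ihat_lt (hm : ∀ x ∈ K, x < m) {a : ℕ} (ha : a ∈ K) (h0 : 0 < a) :
    ∀ x ∈ Ihat K a, x < m - 1 := by
  have h1 := hm a ha
  intro x
  simp only [Ihat, Finset.mem_union, Finset.mem_filter, Finset.mem_image]
  grind

theorem Imod_max (hm : ∀ x ∈ K, x < m) (h0 : 1 < m) (hpos : ∀ x ∈ K, 0 < x) :
    Imod (insert m K) m = insert (m - 1) K := by
  ext x
  simp only [Imod, Finset.mem_erase, Finset.mem_union, Finset.mem_filter, Finset.mem_insert,
    Finset.mem_image]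
  by_cases hx : x = m - 1
  · subst hx
    exact iff_of_true ⟨by omega, Or.inr ⟨m, ⟨Or.inl rfl, by omega⟩, rfl⟩⟩ (Or.inl rfl)
  grind

theorem Ihat_max (hm : ∀ x ∈ K, x < m) :
    Ihat (insert m K) m = K := by
  ext x
  simp only [Ihat, Finset.mem_union, Finset.mem_filter, Finset.mem_insert,
    Finset.mem_image]
  grind

theorem mI_insert (hm : ∀ x ∈ K, x < m) : mI (insert m K) = m := by
  unfold mI
  rw [Finset.sup_insert]
  simp only [id]
  apply sup_eq_left.2
  exact Finset.sup_le fun x hx => (hm x hx).le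

end Sets

/-- The full recursion. -/
def Rec (I : Finset ℕ) : Prop :=
  ∀ n : ℕ, (∀ i ∈ I, i ≤ n) → (dCount I (n + 1) : ℚ) = dCount I n +
    ∑ a ∈ Iprime2 I, (dCount (Imod I a) n : ℚ) + ∑ a ∈ Iprime I, (dCount (Ihat I a) n : ℚ)

theorem rec_step {K : Finset ℕ} {m : ℕ} (hm : ∀ x ∈ K, x < m) (hpos : ∀ x ∈ K, 0 < x)
    (h0 : 0 < m) (hK : Rec K) (n : ℕ) (hn : m ≤ n) :
    (dCount (insert m K) (n + 1) : ℚ) = dCount (insert m K) n +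
    ∑ a ∈ Iprime2 K, (dCount (Imod (insert m K) a) n : ℚ) +
    ∑ a ∈ Iprime K, (dCount (Ihat (insert m K) a) n : ℚ) +
    n.choose (m - 1) * dCount K (m - 1) := by
  obtain ⟨p, rfl⟩ : ∃ p, m = p + 1 := ⟨m - 1, by omega⟩
  simp only [Nat.add_sub_cancel]
  have B := fun (J : Finset ℕ) (p n : ℕ) (h1 : ∀ j ∈ J, j < p) (h2 : p ≤ n) =>
    congrArg (Nat.cast (R := ℚ)) (dCount_choose J p n h1 h2)
  push_cast at B
  have b1 := B K (p + 1) (n + 1) hm (by omega)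
  have b2 := B K (p + 1) n hm (by omega)
  have r1 := hK n (fun i hi => by have := hm i hi; omega)
  have r2 := hK p (fun i hi => by have := hm i hi; omega)
  have s1 : ∑ a ∈ Iprime2 K, (dCount (Imod (insert (p + 1) K) a) n : ℚ) =
      n.choose p * ∑ a ∈ Iprime2 K, (dCount (Imod K a) p : ℚ) -
        ∑ a ∈ Iprime2 K, (dCount (Imod K a) n : ℚ) := by
    rw [Finset.mul_sum, ← Finset.sum_sub_distrib]
    refine Finset.sum_congr rfl fun a ha => ?_
    have haK : a ∈ K := (Finset.mem_filter.1 (Finset.mem_of_mem_erase ha)).1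
    rw [Imod_insert hm haK (hpos a haK)]
    have := B (Imod K a) p n (Imod_lt hm haK (hpos a haK)) (by omega)
    simp only [Nat.add_sub_cancel]
    linarith
  have s2 : ∑ a ∈ Iprime K, (dCount (Ihat (insert (p + 1) K) a) n : ℚ) =
      n.choose p * ∑ a ∈ Iprime K, (dCount (Ihat K a) p : ℚ) -
        ∑ a ∈ Iprime K, (dCount (Ihat K a) n : ℚ) := by
    rw [Finset.mul_sum, ← Finset.sum_sub_distrib]
    refine Finset.sum_congr rfl fun a ha => ?_
    have haK : a ∈ K := (Finset.mem_filter.1 ha).1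
    rw [Ihat_insert hm haK]
    have := B (Ihat K a) p n (Ihat_lt hm haK (hpos a haK)) (by omega)
    simp only [Nat.add_sub_cancel]
    linarith
  have hch : (((n + 1).choose (p + 1) : ℕ) : ℚ) = n.choose p + n.choose (p + 1) := by
    rw [Nat.choose_succ_succ]; push_cast; ring
  rw [hch] at b1
  have r2' := congrArg (fun x : ℚ => (n.choose p : ℚ) * x) r2
  simp only [mul_add] at r2'
  rw [s1, s2]
  linarith

theorem rec_all (I : Finset ℕ) : (∀ i ∈ I, 0 < i) → Rec I := by
  induction I using Finset.induction_on_max with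
  | empty =>
    intro _ n _
    simp [Iprime2, Iprime, dCount_empty]
  | insert m K hm ih =>
    intro hpos
    have hposK : ∀ x ∈ K, 0 < x := fun x hx => hpos x (Finset.mem_insert_of_mem hx)
    have h0 : 0 < m := hpos m (Finset.mem_insert_self _ _)
    intro n hn
    have hmn : m ≤ n := hn m (Finset.mem_insert_self _ _)
    rw [rec_step hm hposK h0 (ih hposK) n hmn]
    rw [← Iprime_insert hm, ← Iprime2_insert hm]
    by_cases hmem : m - 1 ∈ K
    · have hz : dCount K (m - 1) = 0 := dCount_eq_zero hmem le_rfl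
      have h1 : m ∉ Iprime (insert m K) := by simp [Iprime, hmem]
      have h2 : m ∉ Iprime2 (insert m K) := fun h => h1 (Finset.mem_of_mem_erase h)
      rw [Finset.erase_eq_of_notMem h1, Finset.erase_eq_of_notMem h2, hz]
      simp
    · have h1 : m ∈ Iprime (insert m K) := by
        simp [Iprime, hmem]; omega
      have hlt : ∀ j ∈ K, j < m - 1 := by
        intro j hj
        have := hm j hj
        have : j ≠ m - 1 := fun h => hmem (h ▸ hj)
        omega
      rw [← Finset.add_sum_erase _ _ h1, Ihat_max hm]
      by_cases hm1 : m = 1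
      · subst hm1
        have h2 : 1 ∉ Iprime2 (insert 1 K) := by simp [Iprime2]
        have hKe : K = ∅ := by
          rw [Finset.eq_empty_iff_forall_notMem]
          intro x hx
          have := hm x hx
          have := hposK x hx
          omega
        rw [Finset.erase_eq_of_notMem h2]
        subst hKe
        simp [dCount_empty]
        ring
      · have h2 : m ∈ Iprime2 (insert m K) := by
          simp only [Iprime2, Finset.mem_erase]
          exact ⟨hm1, h1⟩
        rw [← Finset.add_sum_erase _ _ h2, Imod_max hm (by omega) hposK]
        have b := congrArg (Nat.cast (R := ℚ)) (dCount_choose K (m - 1) n hlt (by omega))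
        push_cast at b
        linarith

theorem choose_indep (M : ℕ) : ∀ (x : ℕ → ℚ) (N : ℕ),
    (∀ n, N ≤ n → ∑ k ∈ Finset.range M, x k * (n.choose k : ℚ) = 0) → ∀ k < M, x k = 0 := by
  induction M with
  | zero => intro x N _ k hk; omega
  | succ M ih =>
    intro x N h
    have h1 : ∀ k < M, x (k + 1) = 0 := by
      apply ih (fun k => x (k + 1)) N
      intro n hn
      have a1 := h n hn
      have a2 := h (n + 1) (by omega)
      rw [Finset.sum_range_succ'] at a1 a2
      have : ∑ k ∈ Finset.range M, x (k + 1) * (((n + 1).choose (k + 1) : ℕ) : ℚ) =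
          ∑ k ∈ Finset.range M, x (k + 1) * (n.choose k : ℚ) +
          ∑ k ∈ Finset.range M, x (k + 1) * (n.choose (k + 1) : ℚ) := by
        rw [← Finset.sum_add_distrib]
        refine Finset.sum_congr rfl fun k _ => ?_
        rw [Nat.choose_succ_succ]; push_cast; ring
      simp only [Nat.choose_zero_right] at a1 a2
      linarith
    intro k hk
    rcases k with _ | k
    · have a := h N le_rfl
      rw [Finset.sum_range_succ', Finset.sum_eq_zero] at a
      · simpa using a
      · intro i hi
        rw [h1 i (Finset.mem_range.1 hi), zero_mul]
    · exact h1 k (by omega)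

theorem choose_alt (p n : ℕ) : (n.choose p : ℚ) =
    ∑ k ∈ Finset.range (p + 1), (-1 : ℚ) ^ (p - k) * ((n + 1).choose k : ℚ) := by
  induction p with
  | zero => simp
  | succ p ih =>
    rw [Finset.sum_range_succ]
    have : ∑ k ∈ Finset.range (p + 1), (-1 : ℚ) ^ (p + 1 - k) * ((n + 1).choose k : ℚ) =
        - ∑ k ∈ Finset.range (p + 1), (-1 : ℚ) ^ (p - k) * ((n + 1).choose k : ℚ) := by
      rw [← Finset.sum_neg_distrib]
      refine Finset.sum_congr rfl fun k hk => ?_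
      have := Finset.mem_range.1 hk
      rw [show p + 1 - k = (p - k) + 1 by omega, pow_succ]
      ring
    rw [this, ← ih, Nat.choose_succ_succ]
    simp

theorem stmt3_aux {K : Finset ℕ} {p : ℕ} (hm : ∀ x ∈ K, x < p + 1) (hpos : ∀ x ∈ K, 0 < x)
    (c : Finset ℕ → ℕ → ℚ) (hc : ∀ J : Finset ℕ, IsCCoeff J (c J)) (k : ℕ) (hk : k < p + 1) :
    c (insert (p + 1) K) (k + 1) =
      (∑ a ∈ Iprime2 K, c (Imod (insert (p + 1) K) a) k) +
      (∑ a ∈ Iprime K, c (Ihat (insert (p + 1) K) a) k) + dCount K p := by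
  set I := insert (p + 1) K with hI
  have hmI : mI I = p + 1 := mI_insert hm
  let x : ℕ → ℚ := fun k => (-1 : ℚ) ^ (p - k) * (c I (k + 1) -
    ((∑ a ∈ Iprime2 K, c (Imod I a) k) + (∑ a ∈ Iprime K, c (Ihat I a) k) + dCount K p))
  have hx : ∀ k < p + 1, x k = 0 := by
    apply choose_indep (p + 1) x (p + 3)
    intro n' hn'
    obtain ⟨n, rfl⟩ : ∃ n, n' = n + 1 := ⟨n' - 1, by omega⟩
    have r := rec_step hm hpos (by omega) (rec_all K hpos) n (by omega)
    rw [← hI] at r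
    have f1 := (hc I).1 n (by omega)
    have f2 := (hc I).1 (n + 1) (by omega)
    rw [hmI, Finset.sum_range_succ'] at f1 f2
    have f3 : ∑ k ∈ Finset.range (p + 1), (-1 : ℚ) ^ (p + 1 - (k + 1)) * c I (k + 1) *
          (((n + 1 + 1).choose (k + 1) : ℕ) : ℚ) =
        ∑ k ∈ Finset.range (p + 1), (-1 : ℚ) ^ (p - k) * c I (k + 1) *
          (((n + 1).choose k : ℕ) : ℚ) +
        ∑ k ∈ Finset.range (p + 1), (-1 : ℚ) ^ (p + 1 - (k + 1)) * c I (k + 1) *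
          (((n + 1).choose (k + 1) : ℕ) : ℚ) := by
      rw [← Finset.sum_add_distrib]
      refine Finset.sum_congr rfl fun k _ => ?_
      rw [Nat.choose_succ_succ (n + 1), Nat.add_sub_add_right]; push_cast; ring
    have g1 : ∑ a ∈ Iprime2 K, (dCount (Imod I a) n : ℚ) =
        ∑ k ∈ Finset.range (p + 1), (-1 : ℚ) ^ (p - k) * (∑ a ∈ Iprime2 K, c (Imod I a) k) *
          (((n + 1).choose k : ℕ) : ℚ) := by
      simp only [Finset.mul_sum, Finset.sum_mul]
      rw [Finset.sum_comm]
      refine Finset.sum_congr rfl fun a ha => ?_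
      have haK : a ∈ K := (Finset.mem_filter.1 (Finset.mem_of_mem_erase ha)).1
      have e : mI (Imod I a) = p := by
        rw [hI, Imod_insert hm haK (hpos a haK)]
        exact mI_insert (Imod_lt hm haK (hpos a haK))
      have := (hc (Imod I a)).1 n (by omega)
      rw [this, e]
    have g2 : ∑ a ∈ Iprime K, (dCount (Ihat I a) n : ℚ) =
        ∑ k ∈ Finset.range (p + 1), (-1 : ℚ) ^ (p - k) * (∑ a ∈ Iprime K, c (Ihat I a) k) *
          (((n + 1).choose k : ℕ) : ℚ) := by
      simp only [Finset.mul_sum, Finset.sum_mul]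
      rw [Finset.sum_comm]
      refine Finset.sum_congr rfl fun a ha => ?_
      have haK : a ∈ K := (Finset.mem_filter.1 ha).1
      have e : mI (Ihat I a) = p := by
        rw [hI, Ihat_insert hm haK]
        exact mI_insert (Ihat_lt hm haK (hpos a haK))
      have := (hc (Ihat I a)).1 n (by omega)
      rw [this, e]
    have g3 : (n.choose p : ℚ) * dCount K p =
        ∑ k ∈ Finset.range (p + 1), (-1 : ℚ) ^ (p - k) * (dCount K p : ℚ) *
          (((n + 1).choose k : ℕ) : ℚ) := by
      rw [choose_alt, Finset.sum_mul]
      refine Finset.sum_congr rfl fun k _ => ?_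
      ring
    have tot : ∑ k ∈ Finset.range (p + 1), x k * (((n + 1).choose k : ℕ) : ℚ) =
        ∑ k ∈ Finset.range (p + 1), (-1 : ℚ) ^ (p - k) * c I (k + 1) *
          (((n + 1).choose k : ℕ) : ℚ) -
        (∑ a ∈ Iprime2 K, (dCount (Imod I a) n : ℚ) +
          ∑ a ∈ Iprime K, (dCount (Ihat I a) n : ℚ) + (n.choose p : ℚ) * dCount K p) := by
      rw [g1, g2, g3, ← Finset.sum_add_distrib, ← Finset.sum_add_distrib,
        ← Finset.sum_sub_distrib]
      refine Finset.sum_congr rfl fun k _ => ?_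
      simp only [x]
      ring
    rw [tot]
    simp only [Nat.add_sub_cancel] at r
    rw [f3] at f2
    simp only [Nat.choose_zero_right] at f1 f2
    linarith
  have := hx k hk
  simp only [x] at this
  rcases mul_eq_zero.1 this with h | h
  · exact absurd h (pow_ne_zero _ (by norm_num))
  · linarith

/-- For nonempty `I` with `m = max I`, and for every `0 ≤ k ≤ m−1`:
`c_{k+1}(I) = Σ_{i_t ∈ I''∖{m}} c_k(I_t) + Σ_{i_t ∈ I'∖{m}} c_k(Î_t) + d(I⁻, m−1)`.
Here `c J` denotes the (unique) `c`-coefficient sequence of each finite set `J`. -/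
theorem stmt3 (I : Finset ℕ) (hI : I.Nonempty) (hpos : ∀ i ∈ I, 0 < i)
    (c : Finset ℕ → ℕ → ℚ) (hc : ∀ J : Finset ℕ, IsCCoeff J (c J)) :
    ∀ k : ℕ, k ≤ mI I - 1 →
      c I (k + 1) =
        (∑ a ∈ (Iprime2 I).erase (mI I), c (Imod I a) k)
          + (∑ a ∈ (Iprime I).erase (mI I), c (Ihat I a) k)
          + (dCount (I.erase (mI I)) (mI I - 1) : ℚ) := by
  intro k hk
  obtain ⟨m, hmI, hmax⟩ : ∃ m ∈ I, ∀ x ∈ I, x ≤ m :=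
    ⟨I.max' hI, I.max'_mem hI, fun x hx => I.le_max' x hx⟩
  have hlt : ∀ x ∈ I.erase m, x < m := fun x hx =>
    lt_of_le_of_ne (hmax x (Finset.mem_of_mem_erase hx)) (Finset.ne_of_mem_erase hx)
  obtain ⟨p, rfl⟩ : ∃ p, m = p + 1 := ⟨m - 1, by have := hpos m hmI; omega⟩
  have hins : insert (p + 1) (I.erase (p + 1)) = I := Finset.insert_erase hmI
  have hm : mI I = p + 1 := by
    have := mI_insert hlt
    rwa [hins] at this
  have h1 := Iprime_insert hlt
  have h2 := Iprime2_insert hlt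
  have h3 := stmt3_aux hlt (fun x hx => hpos x (Finset.mem_of_mem_erase hx)) c hc k (by omega)
  rw [hins] at h1 h2 h3
  rw [hm, h1, h2, h3]
  rfl
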